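/- Let Ω ⊆ V₀ be an open connected set and let F : Ω + iV₀ → ℂ be holomorphic on the tube Ω + iV₀, with the property that for every compact subset ω ⊂ Ω and every n ∈ ℕ one has sup_{λ ∈ ω + iV₀} (1 + ‖λ‖)ⁿ |F(λ)| < ∞. Then for every η ∈ Ω the integral ∫_{V₀} F(η + iν) dν (with respect to Lebesgue measure on V₀) converges absolutely, and the function η ↦ ∫_{V₀} F(η + iν) dν is constant on Ω. -/

import Mathlib

open Filter Topology MeasureTheory

noncomputable section

/-- The complexification `V` of `V₀`, modelled as `EuclideanSpace ℂ (Fin n)`. -/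
abbrev Vc (n : ℕ) := EuclideanSpace ℂ (Fin n)

/-- `V₀`: a finite-dimensional real inner product space, modelled as `EuclideanSpace ℝ (Fin n)`. -/
abbrev Vr (n : ℕ) := EuclideanSpace ℝ (Fin n)

/-- The real part `Re λ ∈ V₀` of `λ ∈ V`. -/
def reP (n : ℕ) (lam : Vc n) : Vr n := WithLp.toLp 2 (fun i => (lam i).re)

/-- The tube `ω + iV₀ = {λ ∈ V | Re λ ∈ ω}` over a subset `ω ⊆ V₀`. -/
def Tube (n : ℕ) (ω : Set (Vr n)) : Set (Vc n) := {lam | reP n lam ∈ ω}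

/-- The point `η + iν ∈ V` determined by `η, ν ∈ V₀`. -/
def mkC (n : ℕ) (η ν : Vr n) : Vc n := WithLp.toLp 2 (fun i => (η i : ℂ) + Complex.I * (ν i : ℂ))

theorem mkC_add_smul (n : ℕ) (η ν v : Vr n) (z : ℂ) :
    mkC n η ν + z • mkC n v 0 = mkC n (η + z.re • v) (ν + z.im • v) := by
  ext i
  apply Complex.ext <;> simp [mkC]

theorem reP_mkC (n : ℕ) (η ν : Vr n) : reP n (mkC n η ν) = η := by
  ext i
  simp [reP, mkC]

theorem norm_le_norm_mkC (n : ℕ) (η ν : Vr n) : ‖ν‖ ≤ ‖mkC n η ν‖ := by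
  rw [EuclideanSpace.norm_eq, EuclideanSpace.norm_eq]
  gcongr with i
  simpa [mkC] using Complex.abs_im_le_norm ((η i : ℂ) + Complex.I * (ν i : ℂ))

theorem continuous_mkC (n : ℕ) (η : Vr n) : Continuous (mkC n η) := by
  unfold mkC
  fun_prop

theorem continuous_reP (n : ℕ) : Continuous (reP n) := by
  unfold reP
  fun_prop

theorem isOpen_tube (n : ℕ) {Ω : Set (Vr n)} (hΩ : IsOpen Ω) : IsOpen (Tube n Ω) :=
  hΩ.preimage (continuous_reP n)

/-- Polynomial decay of order `n + 1` on a tube gives an integrable majorant that is uniform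
under imaginary translations of length at most `R`. -/
theorem norm_mkC_add_le {n : ℕ} {ω : Set (Vr n)} {F : Vc n → ℂ} {C R : ℝ}
    (hC : ∀ lam : Vc n, reP n lam ∈ ω → (1 + ‖lam‖) ^ (n + 1) * ‖F lam‖ ≤ C)
    {η ν u : Vr n} (hη : η ∈ ω) (hu : ‖u‖ ≤ R) :
    ‖F (mkC n η (ν + u))‖ ≤ C * (1 + R) ^ (n + 1) * (1 + ‖ν‖) ^ (-((n + 1 : ℕ) : ℝ)) := by
  have hR : 0 ≤ R := (norm_nonneg u).trans hu
  have hp := norm_le_norm_mkC n η (ν + u)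
  have hF := hC (mkC n η (ν + u)) (by rwa [reP_mkC])
  have hν : ‖ν‖ ≤ ‖mkC n η (ν + u)‖ + R := by
    have := norm_sub_le (ν + u) u
    rw [add_sub_cancel_right] at this
    linarith
  have hle : 1 + ‖ν‖ ≤ (1 + R) * (1 + ‖mkC n η (ν + u)‖) := by
    nlinarith [mul_nonneg hR (norm_nonneg (mkC n η (ν + u)))]
  rw [Real.rpow_neg (by positivity), Real.rpow_natCast, ← div_eq_mul_inv,
    le_div_iff₀ (by positivity)]
  calc ‖F (mkC n η (ν + u))‖ * (1 + ‖ν‖) ^ (n + 1)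
      ≤ ‖F (mkC n η (ν + u))‖ * ((1 + R) * (1 + ‖mkC n η (ν + u)‖)) ^ (n + 1) := by gcongr
    _ = (1 + ‖mkC n η (ν + u)‖) ^ (n + 1) * ‖F (mkC n η (ν + u))‖ * (1 + R) ^ (n + 1) := by
      rw [mul_pow]; ring
    _ ≤ C * (1 + R) ^ (n + 1) := by gcongr

theorem integrable_one_add_norm_rpow (n : ℕ) :
    Integrable fun ν : Vr n => (1 + ‖ν‖) ^ (-((n + 1 : ℕ) : ℝ)) :=
  integrable_one_add_norm (by simp)

theorem continuous_comp_mkC {n : ℕ} {Ω : Set (Vr n)} {F : Vc n → ℂ}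
    (hF : DifferentiableOn ℂ F (Tube n Ω)) {η : Vr n} (hη : η ∈ Ω) :
    Continuous fun ν : Vr n => F (mkC n η ν) :=
  hF.continuousOn.comp_continuous (continuous_mkC n η) fun ν => by
    simpa [Tube, reP_mkC] using hη

theorem integrable_comp_mkC {n : ℕ} {Ω : Set (Vr n)} {F : Vc n → ℂ}
    (hF : DifferentiableOn ℂ F (Tube n Ω))
    (hdecay : ∀ ω : Set (Vr n), IsCompact ω → ω ⊆ Ω → ∀ m : ℕ,
      ∃ C : ℝ, ∀ lam : Vc n, reP n lam ∈ ω → (1 + ‖lam‖) ^ m * ‖F lam‖ ≤ C)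
    {η : Vr n} (hη : η ∈ Ω) : Integrable fun ν : Vr n => F (mkC n η ν) := by
  obtain ⟨C, hC⟩ := hdecay {η} isCompact_singleton (by simpa using hη) (n + 1)
  refine ((integrable_one_add_norm_rpow n).const_mul (C * (1 + 0) ^ (n + 1))).mono'
    (continuous_comp_mkC hF hη).aestronglyMeasurable (.of_forall fun ν => ?_)
  simpa only [add_zero] using
    norm_mkC_add_le hC (u := 0) (ν := ν) (Set.mem_singleton η) norm_zero.le

/-- The complexified integral depends holomorphically on the complex shift parameter. -/
theorem exists_hasDerivAt_integral_mkC {n : ℕ} {Ω : Set (Vr n)} (hΩ : IsOpen Ω) {F : Vc n → ℂ}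
    (hF : DifferentiableOn ℂ F (Tube n Ω))
    (hdecay : ∀ ω : Set (Vr n), IsCompact ω → ω ⊆ Ω → ∀ m : ℕ,
      ∃ C : ℝ, ∀ lam : Vc n, reP n lam ∈ ω → (1 + ‖lam‖) ^ m * ‖F lam‖ ≤ C)
    {η : Vr n} (hη : η ∈ Ω) (v : Vr n) :
    ∃ d : ℂ, HasDerivAt (fun z : ℂ => ∫ ν : Vr n, F (mkC n η ν + z • mkC n v 0)) d 0 := by
  obtain ⟨R, hR, hball⟩ := Metric.nhds_basis_closedBall.mem_iff.1 (hΩ.mem_nhds hη)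
  obtain ⟨C, hC⟩ := hdecay _ (isCompact_closedBall η R) hball (n + 1)
  obtain ⟨s, hs, hsv⟩ : ∃ s : ℝ, 0 < s ∧ (s + s) * ‖v‖ ≤ R := by
    refine ⟨R / (2 * (‖v‖ + 1)), by positivity, ?_⟩
    field_simp
    nlinarith [norm_nonneg v]
  have hsmul : ∀ {a : ℝ} {w : ℂ}, ‖w‖ ≤ s + s → |a| ≤ ‖w‖ → ‖a • v‖ ≤ R := fun hw ha => by
    rw [norm_smul, Real.norm_eq_abs]
    exact (mul_le_mul_of_nonneg_right (ha.trans hw) (norm_nonneg v)).trans hsv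
  have hre : ∀ {w : ℂ}, ‖w‖ ≤ s + s → η + w.re • v ∈ Metric.closedBall η R := fun {w} hw => by
    simpa using hsmul hw (Complex.abs_re_le_norm w)
  have hdiff : ∀ {w : ℂ} (ν : Vr n), ‖w‖ ≤ s + s →
      DifferentiableAt ℂ F (mkC n η ν + w • mkC n v 0) := fun ν hw => by
    refine hF.differentiableAt ((isOpen_tube n hΩ).mem_nhds ?_)
    change reP n _ ∈ Ω
    rw [mkC_add_smul, reP_mkC]
    exact hball (hre hw)
  have hline : ∀ {w : ℂ} (ν : Vr n), ‖w‖ ≤ s + s →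
      HasDerivAt (fun z : ℂ => F (mkC n η ν + z • mkC n v 0))
        (fderiv ℂ F (mkC n η ν + w • mkC n v 0) (mkC n v 0)) w := fun {w} ν hw => by
    refine (hdiff ν hw).hasFDerivAt.comp_hasDerivAt w ?_
    simpa using ((hasDerivAt_id w).smul_const (mkC n v 0)).const_add (mkC n η ν)
  have hbound : ∀ {w : ℂ} (ν : Vr n), ‖w‖ ≤ s + s → ‖F (mkC n η ν + w • mkC n v 0)‖ ≤
      C * (1 + R) ^ (n + 1) * (1 + ‖ν‖) ^ (-((n + 1 : ℕ) : ℝ)) := fun {w} ν hw => by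
    rw [mkC_add_smul]
    exact norm_mkC_add_le hC (hre hw) (hsmul hw (Complex.abs_im_le_norm w))
  refine ⟨_, (hasDerivAt_integral_of_dominated_loc_of_deriv_le
    (F := fun z ν => F (mkC n η ν + z • mkC n v 0))
    (F' := fun z ν => fderiv ℂ F (mkC n η ν + z • mkC n v 0) (mkC n v 0))
    (bound := fun ν => C * (1 + R) ^ (n + 1) * (1 + ‖ν‖) ^ (-((n + 1 : ℕ) : ℝ)) / s)
    (Metric.ball_mem_nhds 0 hs) ?_ ?_ ?_ ?_ ?_ ?_).2⟩
  · filter_upwards [Metric.ball_mem_nhds (0 : ℂ) hs] with z hz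
    rw [mem_ball_zero_iff] at hz
    have hz' : η + z.re • v ∈ Ω := hball (hre (by linarith))
    simp only [mkC_add_smul]
    exact ((continuous_comp_mkC hF hz').comp (continuous_add_const _)).aestronglyMeasurable
  · simpa using integrable_comp_mkC hF hdecay hη
  · exact ((measurable_fderiv_apply_const ℂ F (mkC n v 0)).comp
      ((continuous_mkC n η).add continuous_const).measurable).aestronglyMeasurable
  · refine .of_forall fun ν z hz => ?_
    rw [mem_ball_zero_iff] at hz
    have hle : ∀ w ∈ Metric.closedBall z s, ‖w‖ ≤ s + s := fun w hw => by
      have := norm_le_norm_add_norm_sub' w z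
      rw [mem_closedBall_iff_norm] at hw
      linarith
    rw [← (hline ν (hle z (Metric.mem_closedBall_self hs.le))).deriv]
    refine Complex.norm_deriv_le_of_forall_mem_sphere_norm_le hs ?_ fun w hw =>
      hbound ν (hle w (Metric.sphere_subset_closedBall hw))
    refine DifferentiableOn.diffContOnCl_ball (U := Metric.closedBall z s) (fun w hw => ?_) subset_rfl
    exact (hline ν (hle w hw)).differentiableAt.differentiableWithinAt
  · exact ((integrable_one_add_norm_rpow n).const_mul _).div_const s
  · refine .of_forall fun ν z hz => hline ν ?_
    rw [mem_ball_zero_iff] at hz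
    linarith

theorem hasDerivAt_integral_mkC_zero {n : ℕ} {Ω : Set (Vr n)} (hΩ : IsOpen Ω) {F : Vc n → ℂ}
    (hF : DifferentiableOn ℂ F (Tube n Ω))
    (hdecay : ∀ ω : Set (Vr n), IsCompact ω → ω ⊆ Ω → ∀ m : ℕ,
      ∃ C : ℝ, ∀ lam : Vc n, reP n lam ∈ ω → (1 + ‖lam‖) ^ m * ‖F lam‖ ≤ C)
    {η : Vr n} (hη : η ∈ Ω) (v : Vr n) :
    HasDerivAt (fun t : ℝ => ∫ ν : Vr n, F (mkC n (η + t • v) ν)) 0 0 := by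
  obtain ⟨d, hd⟩ := exists_hasDerivAt_integral_mkC hΩ hF hdecay hη v
  have hreal : HasDerivAt (fun t : ℝ => ∫ ν : Vr n, F (mkC n (η + t • v) ν)) d 0 := by
    have := HasDerivAt.comp_ofReal (z := 0) (by simpa using hd)
    simpa only [mkC_add_smul, Complex.ofReal_re, Complex.ofReal_im, zero_smul, add_zero] using this
  have him : HasDerivAt (fun _ : ℝ => ∫ ν : Vr n, F (mkC n η ν)) (d * Complex.I) 0 := by
    have hI : HasDerivAt (fun t : ℝ => (t : ℂ) * Complex.I) Complex.I 0 := by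
      simpa using (Complex.ofRealCLM.hasDerivAt (x := 0)).mul_const Complex.I
    have := HasDerivAt.comp (0 : ℝ) (by simpa using hd) hI
    refine this.congr_of_eventuallyEq (.of_forall fun t => ?_)
    simp [mkC_add_smul, integral_add_right_eq_self (fun ν => F (mkC n η ν))]
  have hd0 : d = 0 := by simpa using him.unique (hasDerivAt_const _ _)
  rwa [hd0] at hreal

theorem integral_mkC_eq_of_segment_subset {n : ℕ} {Ω : Set (Vr n)} (hΩ : IsOpen Ω) {F : Vc n → ℂ}
    (hF : DifferentiableOn ℂ F (Tube n Ω))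
    (hdecay : ∀ ω : Set (Vr n), IsCompact ω → ω ⊆ Ω → ∀ m : ℕ,
      ∃ C : ℝ, ∀ lam : Vc n, reP n lam ∈ ω → (1 + ‖lam‖) ^ m * ‖F lam‖ ≤ C)
    {η₁ η₂ : Vr n} (hseg : segment ℝ η₁ η₂ ⊆ Ω) :
    ∫ ν : Vr n, F (mkC n η₁ ν) = ∫ ν : Vr n, F (mkC n η₂ ν) := by
  have hderiv : ∀ t ∈ Set.Icc (0 : ℝ) 1,
      HasDerivAt (fun t : ℝ => ∫ ν : Vr n, F (mkC n (η₁ + t • (η₂ - η₁)) ν)) 0 t := fun t ht => by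
    have hmem : η₁ + t • (η₂ - η₁) ∈ Ω := by
      refine hseg ?_
      rw [segment_eq_image']
      exact ⟨t, ht, rfl⟩
    have h := hasDerivAt_integral_mkC_zero hΩ hF hdecay hmem (η₂ - η₁)
    rw [← sub_self t] at h
    refine (h.comp_sub_const t t).congr_of_eventuallyEq (.of_forall fun x => ?_)
    simp only [add_assoc, ← add_smul, add_sub_cancel]
  have := constant_of_has_deriv_right_zero
    (fun t ht => (hderiv t ht).continuousAt.continuousWithinAt)
    (fun t ht => (hderiv t (Set.Ico_subset_Icc_self ht)).hasDerivWithinAt) 1 (by simp)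
  simpa using this.symm

/-- **Statement 5.** Let `Ω ⊆ V₀` be open and connected and let `F` be holomorphic on the
tube `Ω + iV₀`, such that for every compact `ω ⊂ Ω` and every `m ∈ ℕ` one has
`sup_{λ ∈ ω + iV₀} (1 + ‖λ‖)^m |F(λ)| < ∞`.  Then for every `η ∈ Ω` the integral
`∫_{V₀} F(η + iν) dν` (Lebesgue measure on `V₀`) converges absolutely, and
`η ↦ ∫_{V₀} F(η + iν) dν` is constant on `Ω`. -/
theorem tube_integral_shift_invariant (n : ℕ) (Ω : Set (Vr n))
    (hΩo : IsOpen Ω) (hΩc : IsConnected Ω)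
    (F : Vc n → ℂ) (hF : DifferentiableOn ℂ F (Tube n Ω))
    (hdecay : ∀ ω : Set (Vr n), IsCompact ω → ω ⊆ Ω → ∀ m : ℕ,
      ∃ C : ℝ, ∀ lam : Vc n, reP n lam ∈ ω → (1 + ‖lam‖) ^ m * ‖F lam‖ ≤ C) :
    (∀ η ∈ Ω, Integrable (fun ν : Vr n => F (mkC n η ν))) ∧
    ∀ η₁ ∈ Ω, ∀ η₂ ∈ Ω,
      ∫ ν : Vr n, F (mkC n η₁ ν) = ∫ ν : Vr n, F (mkC n η₂ ν) := by
  refine ⟨fun η hη => integrable_comp_mkC hF hdecay hη, fun η₁ h₁ η₂ h₂ => ?_⟩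
  refine hΩc.isPreconnected.induction₂
    (fun x y => ∫ ν : Vr n, F (mkC n x ν) = ∫ ν : Vr n, F (mkC n y ν))
    (fun x hx => ?_) (fun _ _ _ _ _ _ => Eq.trans) (fun _ _ _ _ => Eq.symm) h₁ h₂
  obtain ⟨r, hr, hball⟩ := Metric.isOpen_iff.1 hΩo x hx
  filter_upwards [mem_nhdsWithin_of_mem_nhds (Metric.ball_mem_nhds x hr)] with y hy
  exact integral_mkC_eq_of_segment_subset hΩo hF hdecay
    (((convex_ball x r).segment_subset (Metric.mem_ball_self hr) hy).trans hball)

end
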